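/- Let d ≥ 3 be an integer, μ > 0, N > 0, ρ > 0, and z₀ ∈ S_ρ. Then ∫_{S_ρ} 2μ·(z₀−z)/(1+‖z₀−z‖²/N) dσ_ρ(z) = c·z₀, where c = (2μ/√π)·(Γ(d/2)/Γ((d−1)/2))·∫_{θ=0}^{π} (1+cos θ)^{(d−1)/2}·(1−cos θ)^{(d−3)/2}·sin θ/(1+2ρ²(1+cos θ)/N) dθ. -/

import Mathlib

open MeasureTheory Metric Real

/-- The uniform probability measure on the sphere of radius `ρ` centered at the
origin in `ℝ^d`, obtained by pushing forward the normalized surface measure on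
the unit sphere along scalar multiplication by `ρ`. -/
noncomputable def sphereUniform (d : ℕ) (ρ : ℝ) :
    Measure (EuclideanSpace ℝ (Fin d)) :=
  Measure.map
    (fun z : sphere (0 : EuclideanSpace ℝ (Fin d)) 1 =>
      ρ • (z : EuclideanSpace ℝ (Fin d)))
    (((volume : Measure (EuclideanSpace ℝ (Fin d))).toSphere Set.univ)⁻¹ •
      (volume : Measure (EuclideanSpace ℝ (Fin d))).toSphere)

open scoped ENNReal Pointwise

theorem lintegral_eq_lintegral_toSphere {E : Type*} [NormedAddCommGroup E] [NormedSpace ℝ E]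
    [MeasurableSpace E] [BorelSpace E] [FiniteDimensional ℝ E] [Nontrivial E]
    (ν : Measure E) [ν.IsAddHaarMeasure] {f : E → ℝ≥0∞} (hf : Measurable f) :
    ∫⁻ x, f x ∂ν = ∫⁻ u : sphere (0 : E) 1, ∫⁻ r in Set.Ioi (0 : ℝ),
      ENNReal.ofReal (r ^ (Module.finrank ℝ E - 1)) * f (r • (u : E)) ∂volume ∂ν.toSphere := by
  have hm : Measurable fun p : sphere (0 : E) 1 × Set.Ioi (0 : ℝ) => f (p.2.1 • (p.1 : E)) := by
    fun_prop
  calc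
    ∫⁻ x, f x ∂ν = ∫⁻ x : ({(0)}ᶜ : Set E), f x ∂(ν.comap (↑)) := by
      rw [lintegral_subtype_comap (measurableSet_singleton _).compl, restrict_compl_singleton]
    _ = ∫⁻ p : sphere (0 : E) 1 × Set.Ioi (0 : ℝ), f (p.2.1 • (p.1 : E))
          ∂ν.toSphere.prod (.volumeIoiPow (Module.finrank ℝ E - 1)) := by
      rw [← ν.measurePreserving_homeomorphUnitSphereProd.lintegral_comp hm]
      refine lintegral_congr fun x => ?_
      congr 1
      have hx : ‖(x : E)‖ ≠ 0 := norm_ne_zero_iff.2 x.2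
      simp [smul_smul, hx]
    _ = _ := by
      rw [lintegral_prod _ hm.aemeasurable]
      refine lintegral_congr fun u => ?_
      rw [Measure.volumeIoiPow, lintegral_withDensity_eq_lintegral_mul _ (by fun_prop) (by fun_prop)]
      exact lintegral_subtype_comap measurableSet_Ioi (fun r : ℝ =>
        ENNReal.ofReal (r ^ (Module.finrank ℝ E - 1)) * f (r • (u : E)))

theorem exists_orthonormalBasis_apply_zero_eq {n : ℕ} {e : EuclideanSpace ℝ (Fin (n + 1))}
    (he : ‖e‖ = 1) :
    ∃ b : OrthonormalBasis (Fin (n + 1)) ℝ (EuclideanSpace ℝ (Fin (n + 1))), b 0 = e := by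
  obtain ⟨b, hb⟩ := Orthonormal.exists_orthonormalBasis_extension_of_card_eq (𝕜 := ℝ)
    (ι := Fin (n + 1)) (E := EuclideanSpace ℝ (Fin (n + 1))) (by simp)
    (v := fun _ => e) (s := {0})
    ⟨fun _ => he, fun i j hij => (hij (Subsingleton.elim i j)).elim⟩
  exact ⟨b, hb 0 rfl⟩

theorem lintegral_fun_inner_norm {n : ℕ} {e : EuclideanSpace ℝ (Fin (n + 1))} (he : ‖e‖ = 1)
    {f : ℝ → ℝ → ℝ≥0∞} (hf : Measurable (Function.uncurry f)) :
    ∫⁻ x : EuclideanSpace ℝ (Fin (n + 1)), f (inner ℝ e x) ‖x‖ =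
      ∫⁻ s : ℝ, ∫⁻ y : EuclideanSpace ℝ (Fin n), f s √(s ^ 2 + ‖y‖ ^ 2) := by
  obtain ⟨b, rfl⟩ := exists_orthonormalBasis_apply_zero_eq he
  have hm : Measurable fun p : ℝ × EuclideanSpace ℝ (Fin n) => f p.1 √(p.1 ^ 2 + ‖p.2‖ ^ 2) :=
    hf.comp (by fun_prop : Measurable fun p : ℝ × EuclideanSpace ℝ (Fin n) =>
      (p.1, √(p.1 ^ 2 + ‖p.2‖ ^ 2)))
  have h1 : MeasurePreserving (fun x : EuclideanSpace ℝ (Fin (n + 1)) =>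
      ((b.repr x) 0, WithLp.toLp 2 (fun i : Fin n => (b.repr x) i.succ)))
      volume (volume.prod volume) := by
    have h2 := volume_preserving_piFinSuccAbove (fun _ : Fin (n + 1) => ℝ) 0
    have h3 := (MeasurePreserving.id (volume : Measure ℝ)).prod
      (PiLp.volume_preserving_toLp (Fin n))
    exact (h3.comp h2).comp ((PiLp.volume_preserving_ofLp (Fin (n + 1))).comp
      b.measurePreserving_repr)
  rw [← lintegral_prod _ hm.aemeasurable, ← h1.lintegral_comp hm]
  refine lintegral_congr fun x => ?_
  have h4 : ‖x‖ = √((b.repr x 0) ^ 2 +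
      ‖(WithLp.toLp 2 (fun i : Fin n => (b.repr x) i.succ) : EuclideanSpace ℝ (Fin n))‖ ^ 2) := by
    rw [← b.repr.norm_map x, EuclideanSpace.norm_eq, EuclideanSpace.norm_eq,
      Real.sq_sqrt (by positivity), Fin.sum_univ_succ]
    simp
  rw [← h4, b.repr_apply_apply]

theorem lintegral_pow_mul_exp_neg (n : ℕ) :
    ∫⁻ r in Set.Ioi (0 : ℝ), ENNReal.ofReal (r ^ n) * ENNReal.ofReal (exp (-r)) =
      ENNReal.ofReal (n.factorial) := by
  have h := Real.GammaIntegral_convergent (s := n + 1) (by positivity)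
  rw [← Real.Gamma_nat_eq_factorial, Real.Gamma_eq_integral (by positivity),
    ofReal_integral_eq_lintegral_ofReal h]
  · refine setLIntegral_congr_fun measurableSet_Ioi fun r (hr : 0 < r) => ?_
    rw [← ENNReal.ofReal_mul (by positivity)]
    simp [mul_comm]
  · filter_upwards [ae_restrict_mem measurableSet_Ioi] with r (hr : 0 < r)
    simp only [Pi.zero_apply]
    positivity

theorem lintegral_halfPlane_polar {F : ℝ → ℝ → ℝ≥0∞} (hF : Measurable (Function.uncurry F)) :
    ∫⁻ s : ℝ, ∫⁻ r in Set.Ioi (0 : ℝ), F s r =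
      ∫⁻ φ in Set.Ioo 0 π, ∫⁻ R in Set.Ioi (0 : ℝ),
        ENNReal.ofReal R * F (R * cos φ) (R * sin φ) := by
  have hG : Measurable ((Set.univ ×ˢ Set.Ioi (0 : ℝ)).indicator (Function.uncurry F)) :=
    hF.indicator (MeasurableSet.univ.prod measurableSet_Ioi)
  have hsymm : Measurable (fun p : ℝ × ℝ => polarCoord.symm p) :=
    continuous_polarCoord_symm.measurable
  have h1 : ∫⁻ s : ℝ, ∫⁻ r in Set.Ioi (0 : ℝ), F s r =
      ∫⁻ p : ℝ × ℝ, (Set.univ ×ˢ Set.Ioi (0 : ℝ)).indicator (Function.uncurry F) p := by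
    rw [Measure.volume_eq_prod, lintegral_prod _ hG.aemeasurable]
    refine lintegral_congr fun s => ?_
    rw [← lintegral_indicator measurableSet_Ioi]
    refine lintegral_congr fun r => ?_
    by_cases hr : 0 < r <;> simp [Set.indicator, hr]
  rw [h1, ← lintegral_comp_polarCoord_symm, polarCoord_target, Measure.volume_eq_prod,
    ← Measure.prod_restrict, lintegral_prod_symm]
  · have hsub : Set.Ioo 0 π ⊆ Set.Ioo (-π) π := Set.Ioo_subset_Ioo_left (by linarith [pi_pos])
    have hIoo : MeasurableSet (Set.Ioo 0 π) := measurableSet_Ioo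
    rw [← Set.inter_eq_self_of_subset_left hsub, ← Measure.restrict_restrict hIoo,
      ← lintegral_indicator hIoo]
    refine setLIntegral_congr_fun measurableSet_Ioo fun φ hφ => ?_
    by_cases h : 0 < φ
    · have hs : 0 < sin φ := sin_pos_of_pos_of_lt_pi h hφ.2
      rw [Set.indicator_of_mem (show φ ∈ Set.Ioo 0 π from ⟨h, hφ.2⟩)]
      refine setLIntegral_congr_fun measurableSet_Ioi fun R (hR : 0 < R) => ?_
      have : 0 < R * sin φ := by positivity
      simp [Set.indicator, polarCoord_symm_apply, this]
    · have hs : sin φ ≤ 0 := sin_nonpos_of_nonpos_of_neg_pi_le (not_lt.1 h) hφ.1.le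
      rw [Set.indicator_of_notMem (by simp [h])]
      refine (setLIntegral_congr_fun measurableSet_Ioi fun R (hR : 0 < R) => ?_).trans
        lintegral_zero
      have : ¬ 0 < R * sin φ := not_lt.2 (mul_nonpos_of_nonneg_of_nonpos hR.le hs)
      simp [Set.indicator, polarCoord_symm_apply, this]
  · exact ((ENNReal.measurable_ofReal.comp measurable_fst).smul (hG.comp hsymm)).aemeasurable

theorem lintegral_toSphere_inner {n : ℕ} (hn : 1 ≤ n) {e : EuclideanSpace ℝ (Fin (n + 1))}
    (he : ‖e‖ = 1) {g : ℝ → ℝ≥0∞} (hg : Measurable g) :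
    ∫⁻ u : sphere (0 : EuclideanSpace ℝ (Fin (n + 1))) 1, g (inner ℝ e (u : _))
        ∂(volume : Measure (EuclideanSpace ℝ (Fin (n + 1)))).toSphere =
      (volume : Measure (EuclideanSpace ℝ (Fin n))).toSphere Set.univ *
        ∫⁻ φ in Set.Ioo 0 π, ENNReal.ofReal (sin φ ^ (n - 1)) * g (cos φ) := by
  have : Nonempty (Fin n) := ⟨⟨0, hn⟩⟩
  set K : ℝ≥0∞ := ENNReal.ofReal (n.factorial) with hK
  have hK0 : K ≠ 0 := by simp [hK, Nat.factorial_ne_zero]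
  have hKt : K ≠ ∞ := ENNReal.ofReal_ne_top
  let f : ℝ → ℝ → ℝ≥0∞ := fun s t => g (s / t) * ENNReal.ofReal (exp (-t))
  have hf : Measurable (Function.uncurry f) := by
    simp only [f, Function.uncurry_def]
    fun_prop
  have hleft : ∫⁻ x : EuclideanSpace ℝ (Fin (n + 1)), f (inner ℝ e x) ‖x‖ =
      (∫⁻ u : sphere (0 : EuclideanSpace ℝ (Fin (n + 1))) 1, g (inner ℝ e (u : _))
        ∂(volume : Measure (EuclideanSpace ℝ (Fin (n + 1)))).toSphere) * K := by
    rw [lintegral_eq_lintegral_toSphere volume (f := fun x => f (inner ℝ e x) ‖x‖)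
      (hf.comp (by fun_prop : Measurable fun x : EuclideanSpace ℝ (Fin (n + 1)) =>
        (inner ℝ e x, ‖x‖))), ← lintegral_mul_const _ (by fun_prop)]
    refine lintegral_congr fun u => ?_
    rw [hK, ← lintegral_pow_mul_exp_neg, ← lintegral_const_mul _ (by fun_prop)]
    refine setLIntegral_congr_fun measurableSet_Ioi fun r (hr : 0 < r) => ?_
    have hu : ‖(u : EuclideanSpace ℝ (Fin (n + 1)))‖ = 1 := by simp
    simp only [f, inner_smul_right, norm_smul, hu,
      Real.norm_of_nonneg hr.le, mul_one, mul_div_cancel_left₀ _ hr.ne', finrank_euclideanSpace,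
      Fintype.card_fin, Nat.add_sub_cancel]
    ring
  have hright : ∫⁻ x : EuclideanSpace ℝ (Fin (n + 1)), f (inner ℝ e x) ‖x‖ =
      ((volume : Measure (EuclideanSpace ℝ (Fin n))).toSphere Set.univ *
        ∫⁻ φ in Set.Ioo 0 π, ENNReal.ofReal (sin φ ^ (n - 1)) * g (cos φ)) * K := by
    have hF : Measurable (Function.uncurry fun s r : ℝ =>
        ENNReal.ofReal (r ^ (n - 1)) * f s √(s ^ 2 + r ^ 2)) := by
      simp only [f, Function.uncurry_def]
      fun_prop
    rw [lintegral_fun_inner_norm he hf]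
    calc
      _ = ∫⁻ s : ℝ, (volume : Measure (EuclideanSpace ℝ (Fin n))).toSphere Set.univ *
          ∫⁻ r in Set.Ioi (0 : ℝ), ENNReal.ofReal (r ^ (n - 1)) * f s √(s ^ 2 + r ^ 2) := by
        refine lintegral_congr fun s => ?_
        rw [lintegral_eq_lintegral_toSphere volume (f := fun y => f s √(s ^ 2 + ‖y‖ ^ 2))
          (hf.comp (by fun_prop : Measurable fun y : EuclideanSpace ℝ (Fin n) =>
            (s, √(s ^ 2 + ‖y‖ ^ 2)))), mul_comm, ← lintegral_const]
        refine lintegral_congr fun u => ?_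
        refine setLIntegral_congr_fun measurableSet_Ioi fun r (hr : 0 < r) => ?_
        have hu : ‖(u : EuclideanSpace ℝ (Fin n))‖ = 1 := by simp
        simp [norm_smul, hu]
      _ = _ := by
        rw [lintegral_const_mul _ (Measurable.lintegral_prod_right hF),
          lintegral_halfPlane_polar hF, mul_assoc, ← lintegral_mul_const _ (by fun_prop)]
        congr 1
        refine setLIntegral_congr_fun measurableSet_Ioo fun φ hφ => ?_
        have hs : 0 < sin φ := sin_pos_of_mem_Ioo hφ
        rw [hK, ← lintegral_pow_mul_exp_neg, ← lintegral_const_mul _ (by fun_prop)]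
        refine setLIntegral_congr_fun measurableSet_Ioi fun R (hR : 0 < R) => ?_
        have hsq : √((R * cos φ) ^ 2 + (R * sin φ) ^ 2) = R := by
          rw [show (R * cos φ) ^ 2 + (R * sin φ) ^ 2 = R ^ 2 by
            linear_combination R ^ 2 * sin_sq_add_cos_sq φ, sqrt_sq hR.le]
        have hpow : R ^ n = R * R ^ (n - 1) := by rw [← pow_succ', Nat.sub_add_cancel hn]
        simp only [f, hsq, mul_div_cancel_left₀ _ hR.ne']
        rw [mul_pow, hpow]
        rw [ENNReal.ofReal_mul (by positivity), ENNReal.ofReal_mul (by positivity)]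
        ring
  exact (ENNReal.mul_left_inj hK0 hKt).1 (hleft.symm.trans hright)

theorem integral_toSphere_inner {n : ℕ} (hn : 1 ≤ n) {e : EuclideanSpace ℝ (Fin (n + 1))}
    (he : ‖e‖ = 1) {h : ℝ → ℝ} (hm : Measurable h) (h0 : ∀ t ∈ Set.Icc (-1) 1, 0 ≤ h t) :
    ∫ u : sphere (0 : EuclideanSpace ℝ (Fin (n + 1))) 1, h (inner ℝ e (u : _))
        ∂(volume : Measure (EuclideanSpace ℝ (Fin (n + 1)))).toSphere =
      (volume : Measure (EuclideanSpace ℝ (Fin n))).toSphere.real Set.univ *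
        ∫ φ in 0..π, sin φ ^ (n - 1) * h (cos φ) := by
  rw [intervalIntegral.integral_of_le pi_pos.le, integral_Ioc_eq_integral_Ioo,
    integral_eq_lintegral_of_nonneg_ae, integral_eq_lintegral_of_nonneg_ae,
    lintegral_toSphere_inner hn he (g := fun t => ENNReal.ofReal (h t)) (by fun_prop),
    ENNReal.toReal_mul, measureReal_def]
  · congr 2
    refine setLIntegral_congr_fun measurableSet_Ioo fun φ hφ => ?_
    have hs : 0 < sin φ := sin_pos_of_mem_Ioo hφ
    rw [ENNReal.ofReal_mul (by positivity)]
  · filter_upwards [ae_restrict_mem measurableSet_Ioo] with φ hφ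
    have hs : 0 < sin φ := sin_pos_of_mem_Ioo hφ
    exact mul_nonneg (by positivity) (h0 _ ⟨neg_one_le_cos φ, cos_le_one φ⟩)
  · exact (by fun_prop : Measurable fun φ => sin φ ^ (n - 1) * h (cos φ)).aestronglyMeasurable
  · refine Filter.Eventually.of_forall fun u => h0 _ (abs_le.1 ?_)
    have hu : ‖(u : EuclideanSpace ℝ (Fin (n + 1)))‖ = 1 := by simp
    simpa [he, hu] using abs_real_inner_le_norm e (u : EuclideanSpace ℝ (Fin (n + 1)))
  · exact (by fun_prop : Measurable fun u : sphere (0 : EuclideanSpace ℝ (Fin (n + 1))) 1 =>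
      h (inner ℝ e (u : _))).aestronglyMeasurable

theorem toSphere_real_univ_euclideanSpace {n : ℕ} (hn : 1 ≤ n) :
    (volume : Measure (EuclideanSpace ℝ (Fin n))).toSphere.real Set.univ =
      2 * √π ^ n / Gamma (n / 2) := by
  have : Nonempty (Fin n) := ⟨⟨0, hn⟩⟩
  have hn0 : (0 : ℝ) < n := by exact_mod_cast hn
  have hG : 0 < Gamma ((n : ℝ) / 2) := Gamma_pos_of_pos (by positivity)
  have hG1 : 0 < Gamma ((n : ℝ) / 2 + 1) := Gamma_pos_of_pos (by positivity)
  rw [Measure.toSphere_real_apply_univ, measureReal_def, EuclideanSpace.volume_ball]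
  simp only [Fintype.card_fin, finrank_euclideanSpace, ENNReal.ofReal_one, one_pow, one_mul]
  rw [ENNReal.toReal_ofReal (by positivity), Gamma_add_one (by positivity)]
  field_simp

theorem map_isometry_sphereUniform (d : ℕ) (ρ : ℝ)
    (R : EuclideanSpace ℝ (Fin d) ≃ₗᵢ[ℝ] EuclideanSpace ℝ (Fin d)) :
    (sphereUniform d ρ).map R = sphereUniform d ρ := by
  let R' : sphere (0 : EuclideanSpace ℝ (Fin d)) 1 → sphere (0 : EuclideanSpace ℝ (Fin d)) 1 :=
    fun u => ⟨R u, by simp⟩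
  have hR' : Measurable R' := (R.continuous.measurable.comp measurable_subtype_coe).subtype_mk
  have hmap : (volume : Measure (EuclideanSpace ℝ (Fin d))).toSphere.map R' =
      (volume : Measure (EuclideanSpace ℝ (Fin d))).toSphere := by
    ext s hs
    rw [Measure.map_apply hR' hs, Measure.toSphere_apply' _ hs,
      Measure.toSphere_apply' _ (hR' hs)]
    congr 1
    have hset : Set.Ioo (0 : ℝ) 1 • ((↑) '' s : Set (EuclideanSpace ℝ (Fin d))) =
        R '' (Set.Ioo (0 : ℝ) 1 • ((↑) '' (R' ⁻¹' s) : Set (EuclideanSpace ℝ (Fin d)))) := by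
      ext x
      simp only [Set.mem_smul, Set.mem_image]
      constructor
      · rintro ⟨r, hr, _, ⟨u, hu, rfl⟩, rfl⟩
        refine ⟨r • R.symm u, ⟨r, hr, R.symm u, ⟨⟨R.symm u, by simp⟩, ?_, rfl⟩, rfl⟩, by simp⟩
        simpa [R'] using hu
      · rintro ⟨_, ⟨r, hr, _, ⟨u, hu, rfl⟩, rfl⟩, rfl⟩
        exact ⟨r, hr, R u, ⟨R' u, hu, rfl⟩, by simp⟩
    rw [hset, R.image_eq_preimage_symm]
    exact (R.symm.measurePreserving.measure_preimage_emb
      R.symm.toHomeomorph.measurableEmbedding _).symm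
  have hcoe : Measurable fun z : sphere (0 : EuclideanSpace ℝ (Fin d)) 1 =>
      ρ • (z : EuclideanSpace ℝ (Fin d)) := by fun_prop
  rw [sphereUniform, Measure.map_map R.continuous.measurable hcoe]
  conv_rhs => rw [← hmap, ← Measure.map_smul, Measure.map_map hcoe hR', hmap]
  congr 1
  ext1 u
  simp [R']

theorem integral_sphereUniform {F : Type*} [NormedAddCommGroup F] [NormedSpace ℝ F]
    (d : ℕ) (ρ : ℝ) {f : EuclideanSpace ℝ (Fin d) → F} (hf : Continuous f) :
    ∫ z, f z ∂(sphereUniform d ρ) =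
      ((volume : Measure (EuclideanSpace ℝ (Fin d))).toSphere.real Set.univ)⁻¹ •
        ∫ u : sphere (0 : EuclideanSpace ℝ (Fin d)) 1, f (ρ • (u : _))
          ∂(volume : Measure (EuclideanSpace ℝ (Fin d))).toSphere := by
  rw [sphereUniform, integral_map (by fun_prop) hf.aestronglyMeasurable, integral_smul_measure,
    ENNReal.toReal_inv, measureReal_def]

theorem integrable_sphereUniform {F : Type*} [NormedAddCommGroup F]
    {d : ℕ} (hd : 1 ≤ d) (ρ : ℝ) {f : EuclideanSpace ℝ (Fin d) → F} (hf : Continuous f) :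
    Integrable f (sphereUniform d ρ) := by
  have : Nonempty (Fin d) := ⟨⟨0, hd⟩⟩
  rw [sphereUniform, integrable_map_measure hf.aestronglyMeasurable (by fun_prop)]
  refine Integrable.smul_measure ?_ ?_
  · exact (hf.comp (by fun_prop)).integrable_of_hasCompactSupport
      (HasCompactSupport.of_compactSpace _)
  · exact ENNReal.inv_ne_top.2 (Measure.measure_univ_ne_zero.2 (Measure.toSphere_ne_zero _))

theorem one_add_cos_mul_rpow_eq {n : ℕ} (hn : 2 ≤ n) {θ : ℝ} (hθ : θ ∈ Set.Icc 0 π) :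
    (1 + cos θ) ^ ((n : ℝ) / 2) * (1 - cos θ) ^ (((n : ℝ) - 2) / 2) * sin θ =
      sin θ ^ (n - 1) * (1 + cos θ) := by
  obtain ⟨k, rfl⟩ := Nat.exists_eq_add_of_le' hn
  have hs : 0 ≤ sin θ := sin_nonneg_of_mem_Icc hθ
  have ha : 0 ≤ 1 + cos θ := by linarith [neg_one_le_cos θ]
  have hb : 0 ≤ 1 - cos θ := by linarith [cos_le_one θ]
  have hk : ((k : ℝ) / 2) + 1 ≠ 0 := by positivity
  rw [show ((k + 2 : ℕ) : ℝ) / 2 = (k : ℝ) / 2 + 1 by push_cast; ring,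
    show (((k + 2 : ℕ) : ℝ) - 2) / 2 = (k : ℝ) / 2 by push_cast; ring,
    rpow_add_one' ha hk, mul_right_comm _ (1 + cos θ), ← mul_rpow ha hb,
    show (1 + cos θ) * (1 - cos θ) = sin θ ^ 2 by linear_combination -sin_sq_add_cos_sq θ,
    ← rpow_natCast_mul hs, show ((2 : ℕ) : ℝ) * ((k : ℝ) / 2) = k by push_cast; ring, rpow_natCast,
    show k + 2 - 1 = k + 1 by omega]
  ring

/-- The aggregated repulsive force on a point `z₀` of the sphere of radius `ρ`
equals an explicit scalar multiple of `z₀`, given by a one-dimensional angular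
integral. -/
theorem sphere_repulsive_integral
    (d : ℕ) (hd : 3 ≤ d) (μ N ρ : ℝ) (hμ : 0 < μ) (hN : 0 < N) (hρ : 0 < ρ)
    (z₀ : EuclideanSpace ℝ (Fin d))
    (hz₀ : z₀ ∈ sphere (0 : EuclideanSpace ℝ (Fin d)) ρ) :
    ∫ z, (2 * μ / (1 + ‖z₀ - z‖ ^ 2 / N)) • (z₀ - z) ∂(sphereUniform d ρ)
      = ((2 * μ / Real.sqrt π) *
            (Real.Gamma ((d : ℝ) / 2) / Real.Gamma (((d : ℝ) - 1) / 2)) *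
            ∫ θ in (0 : ℝ)..π,
              (1 + Real.cos θ) ^ (((d : ℝ) - 1) / 2) *
                (1 - Real.cos θ) ^ (((d : ℝ) - 3) / 2) * Real.sin θ /
                (1 + 2 * ρ ^ 2 * (1 + Real.cos θ) / N)) • z₀ := by
  obtain ⟨n, rfl⟩ : ∃ n, d = n + 1 := ⟨d - 1, by omega⟩
  have hn : 2 ≤ n := by omega
  have hnorm : ‖z₀‖ = ρ := by simpa using hz₀
  have hz : z₀ ≠ 0 := by
    rintro rfl
    simp at hnorm
    exact hρ.ne hnorm
  set f : EuclideanSpace ℝ (Fin (n + 1)) → EuclideanSpace ℝ (Fin (n + 1)) :=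
    fun z => (2 * μ / (1 + ‖z₀ - z‖ ^ 2 / N)) • (z₀ - z) with hf
  have hden : ∀ z : EuclideanSpace ℝ (Fin (n + 1)), 1 + ‖z₀ - z‖ ^ 2 / N ≠ 0 :=
    fun z => by positivity
  have hfc : Continuous f := by
    refine Continuous.smul (Continuous.div (by fun_prop) (by fun_prop) hden) (by fun_prop)
  set v := ∫ z, f z ∂(sphereUniform (n + 1) ρ) with hv
  -- The reflection fixing the line through `z₀` fixes the integral.
  have hspan : v ∈ Submodule.span ℝ {z₀} := by
    rw [← Submodule.reflection_eq_self_iff]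
    set R := (Submodule.span ℝ {z₀}).reflection with hR
    have hRz : R z₀ = z₀ :=
      (Submodule.reflection_eq_self_iff _).2 (Submodule.mem_span_singleton_self z₀)
    have hfR : ∀ z, R (f z) = f (R z) := fun z => by
      have : ‖z₀ - R z‖ = ‖z₀ - z‖ := by
        conv_lhs => rw [← hRz, ← map_sub, R.norm_map]
      simp only [hf, map_smul, map_sub, this, hRz]
    calc
      R v = ∫ z, R (f z) ∂(sphereUniform (n + 1) ρ) :=
        (R.toContinuousLinearEquiv.integral_comp_comm f).symm
      _ = ∫ z, f z ∂(sphereUniform (n + 1) ρ).map R := by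
        rw [integral_map R.continuous.aemeasurable hfc.aestronglyMeasurable]
        simp only [hfR]
      _ = v := by rw [map_isometry_sphereUniform]
  obtain ⟨c, hc⟩ := Submodule.mem_span_singleton.1 hspan
  rw [← hc]
  congr 1
  have hinner : c * ρ ^ 2 = inner ℝ z₀ v := by
    rw [← hc, inner_smul_right, real_inner_self_eq_norm_sq, hnorm]
  rw [hv, ← integral_inner (integrable_sphereUniform (by omega) ρ hfc),
    integral_sphereUniform _ _ (by fun_prop)] at hinner
  set e := ρ⁻¹ • z₀ with he
  have he1 : ‖e‖ = 1 := by
    rw [he, norm_smul, norm_inv, Real.norm_of_nonneg hρ.le, hnorm, inv_mul_cancel₀ hρ.ne']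
  let h : ℝ → ℝ := fun t => 2 * μ * (ρ ^ 2 * (1 - t)) / (1 + 2 * ρ ^ 2 * (1 - t) / N)
  have hh : ∀ u : sphere (0 : EuclideanSpace ℝ (Fin (n + 1))) 1,
      inner ℝ z₀ (f (ρ • (u : EuclideanSpace ℝ (Fin (n + 1))))) = h (inner ℝ e (u : _)) := by
    intro u
    have hu : ‖(u : EuclideanSpace ℝ (Fin (n + 1)))‖ = 1 := by simp
    have hi : inner ℝ z₀ (u : EuclideanSpace ℝ (Fin (n + 1))) = ρ * inner ℝ e (u : _) := by
      rw [he, real_inner_smul_left, mul_inv_cancel_left₀ hρ.ne']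
    have hd : ‖z₀ - ρ • (u : EuclideanSpace ℝ (Fin (n + 1)))‖ ^ 2 =
        2 * ρ ^ 2 * (1 - inner ℝ e (u : _)) := by
      rw [norm_sub_sq_real, inner_smul_right, hi, norm_smul, Real.norm_of_nonneg hρ.le, hu, hnorm]
      ring
    simp only [hf, h, inner_smul_right, inner_sub_right, real_inner_self_eq_norm_sq, hd, hnorm, hi]
    ring
  have h0 : ∀ t ∈ Set.Icc (-1 : ℝ) 1, 0 ≤ h t := fun t ht => by
    have : 0 ≤ 1 - t := by linarith [ht.2]
    positivity
  simp only [hh] at hinner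
  rw [integral_toSphere_inner (by omega) he1 (by fun_prop) h0,
    toSphere_real_univ_euclideanSpace (by omega), toSphere_real_univ_euclideanSpace (by omega),
    smul_eq_mul] at hinner
  have hint : ∫ φ in 0..π, sin φ ^ (n - 1) * h (cos φ) = 2 * μ * ρ ^ 2 * ∫ θ in (0 : ℝ)..π,
      (1 + Real.cos θ) ^ (((n + 1 : ℕ) - 1 : ℝ) / 2) *
        (1 - Real.cos θ) ^ (((n + 1 : ℕ) - 3 : ℝ) / 2) * Real.sin θ /
        (1 + 2 * ρ ^ 2 * (1 + Real.cos θ) / N) := by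
    have hsub := intervalIntegral.integral_comp_sub_left
      (fun φ => sin φ ^ (n - 1) * h (cos φ)) (a := 0) (b := π) π
    simp only [sub_self, sub_zero] at hsub
    rw [← hsub, ← intervalIntegral.integral_const_mul]
    refine intervalIntegral.integral_congr fun θ hθ => ?_
    rw [Set.uIcc_of_le pi_pos.le] at hθ
    have := one_add_cos_mul_rpow_eq hn hθ
    simp only [sin_pi_sub, cos_pi_sub, h, sub_neg_eq_add]
    rw [show (((n + 1 : ℕ) : ℝ) - 1) / 2 = (n : ℝ) / 2 by push_cast; ring,
      show (((n + 1 : ℕ) : ℝ) - 3) / 2 = ((n : ℝ) - 2) / 2 by push_cast; ring, this]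
    ring
  rw [hint] at hinner
  set I := ∫ θ in (0 : ℝ)..π,
      (1 + Real.cos θ) ^ (((n + 1 : ℕ) - 1 : ℝ) / 2) *
        (1 - Real.cos θ) ^ (((n + 1 : ℕ) - 3 : ℝ) / 2) * Real.sin θ /
        (1 + 2 * ρ ^ 2 * (1 + Real.cos θ) / N)
  have hn0 : (0 : ℝ) < n := by exact_mod_cast (by omega : 0 < n)
  have hG1 : 0 < Gamma (((n + 1 : ℕ) : ℝ) / 2) := Gamma_pos_of_pos (by positivity)
  have hG2 : 0 < Gamma ((n : ℝ) / 2) := Gamma_pos_of_pos (by positivity)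
  have hπ : 0 < √π := sqrt_pos.2 pi_pos
  rw [show (((n + 1 : ℕ) : ℝ) - 1) / 2 = (n : ℝ) / 2 by push_cast; ring]
  refine mul_right_cancel₀ (pow_ne_zero 2 hρ.ne') (hinner.trans ?_)
  rw [pow_succ]
  field_simp
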